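/- Let l, l1, l2 be lightlike vectors in the closed forward light cone V̄+ such that {l, l1} and {l, l2} are each linearly independent. Then the causal complement (W[l,l1] ∩ W[l,l2])' of the intersection of the two wedges is path connected. -/

import Mathlib

noncomputable section

/-- Minkowski spacetime: ℝ⁴. -/
abbrev M4 : Type := Fin 4 → ℝ

/-- Minkowski bilinear form. -/
def mink (x y : M4) : ℝ := x 0 * y 0 - x 1 * y 1 - x 2 * y 2 - x 3 * y 3

/-- Lightlike vector. -/
def Lightlike (l : M4) : Prop := l ≠ 0 ∧ mink l l = 0

/-- Closed forward light cone. -/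
def closedForwardCone : Set M4 := {x | 0 ≤ mink x x ∧ 0 ≤ x 0}

/-- Open forward light cone. -/
def openForwardCone : Set M4 := {x | 0 < mink x x ∧ 0 < x 0}

/-- The wedge W[l₁,l₂]. -/
def wedge (l1 l2 : M4) : Set M4 :=
  {x | ∃ (α β : ℝ) (p : M4), 0 < α ∧ β < 0 ∧ mink p l1 = 0 ∧ mink p l2 = 0 ∧
      x = α • l1 + β • l2 + p}

/-- Spacelike complement of a set. -/
def scomp (S : Set M4) : Set M4 := {x | ∀ s ∈ S, mink (x - s) (x - s) < 0}

/-- Causal complement: the interior of the spacelike complement. -/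
def ccomp (S : Set M4) : Set M4 := interior (scomp S)

lemma mink_comm (x y : M4) : mink x y = mink y x := by
  simp only [mink]; ring

lemma mink_add_left (x y z : M4) : mink (x + y) z = mink x z + mink y z := by
  simp only [mink, Pi.add_apply]; ring

lemma mink_sub_left (x y z : M4) : mink (x - y) z = mink x z - mink y z := by
  simp only [mink, Pi.sub_apply]; ring

lemma mink_neg_left (x y : M4) : mink (-x) y = -mink x y := by
  simp only [mink, Pi.neg_apply]; ring

lemma mink_smul_left (a : ℝ) (x y : M4) : mink (a • x) y = a * mink x y := by
  simp only [mink, Pi.smul_apply, smul_eq_mul]; ring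

lemma continuous_mink_left (y : M4) : Continuous fun x : M4 => mink x y := by
  unfold mink; fun_prop

lemma mink_nonneg_of_mem_closedForwardCone {x y : M4} (hx : x ∈ closedForwardCone)
    (hy : y ∈ closedForwardCone) : 0 ≤ mink x y := by
  obtain ⟨hx, hx0⟩ := hx
  obtain ⟨hy, hy0⟩ := hy
  simp only [mink] at *
  have key : x 1 * y 1 + x 2 * y 2 + x 3 * y 3 ≤ x 0 * y 0 := by
    refine abs_le_of_sq_le_sq' ?_ (mul_nonneg hx0 hy0) |>.2
    have hmul : (x 1 ^ 2 + x 2 ^ 2 + x 3 ^ 2) * (y 1 ^ 2 + y 2 ^ 2 + y 3 ^ 2)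
        ≤ x 0 ^ 2 * y 0 ^ 2 := by
      apply mul_le_mul <;> nlinarith
    nlinarith [sq_nonneg (x 1 * y 2 - x 2 * y 1), sq_nonneg (x 1 * y 3 - x 3 * y 1),
      sq_nonneg (x 2 * y 3 - x 3 * y 2)]
  linarith

lemma Lightlike.zero_ne_zero {l : M4} (hl : Lightlike l) : l 0 ≠ 0 := by
  intro h0
  obtain ⟨hne, hl⟩ := hl
  simp only [mink, h0] at hl
  apply hne
  ext i
  fin_cases i
  · exact h0
  all_goals
    refine pow_eq_zero_iff two_ne_zero |>.1 ?_
    simp only [Fin.mk_one, Fin.reduceFinMk]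
    nlinarith [sq_nonneg (l 1), sq_nonneg (l 2), sq_nonneg (l 3)]

lemma mink_pos_of_lightlike {l k : M4} (hl : Lightlike l) (hk : Lightlike k)
    (hcl : l ∈ closedForwardCone) (hck : k ∈ closedForwardCone)
    (hli : LinearIndependent ℝ ![l, k]) : 0 < mink l k := by
  refine (mink_nonneg_of_mem_closedForwardCone hcl hck).lt_of_ne' fun h => ?_
  refine hk.zero_ne_zero (LinearIndependent.pair_iff.1 hli (k 0) (-l 0) ?_).1
  have hll := hl.2
  have hkk := hk.2
  simp only [mink] at h hll hkk
  have hsum : (k 0 * l 1 - l 0 * k 1) ^ 2 + (k 0 * l 2 - l 0 * k 2) ^ 2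
      + (k 0 * l 3 - l 0 * k 3) ^ 2 = 0 := by
    linear_combination (-(k 0) ^ 2) * hll - (l 0) ^ 2 * hkk + 2 * k 0 * l 0 * h
  ext i
  simp only [Pi.add_apply, Pi.smul_apply, smul_eq_mul, Pi.zero_apply]
  fin_cases i
  · simp only [Fin.zero_eta]; ring
  all_goals
    refine pow_eq_zero_iff two_ne_zero |>.1 ?_
    simp only [Fin.mk_one, Fin.reduceFinMk]
    nlinarith [sq_nonneg (k 0 * l 1 - l 0 * k 1), sq_nonneg (k 0 * l 2 - l 0 * k 2),
      sq_nonneg (k 0 * l 3 - l 0 * k 3)]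

lemma mem_wedge_iff {l k x : M4} (hl : Lightlike l) (hk : Lightlike k) (hlk : 0 < mink l k) :
    x ∈ wedge l k ↔ 0 < mink x k ∧ mink x l < 0 := by
  have hkl := mink_comm k l
  have hll := hl.2
  have hkk := hk.2
  constructor
  · rintro ⟨α, β, p, hα, hβ, hpl, hpk, rfl⟩
    simp only [mink_add_left, mink_smul_left, hll, hkk, hpl, hpk, hkl]
    constructor <;> nlinarith
  · rintro ⟨hxk, hxl⟩
    refine ⟨mink x k / mink l k, mink x l / mink l k,
      x - (mink x k / mink l k) • l - (mink x l / mink l k) • k,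
      div_pos hxk hlk, div_neg_of_neg_of_pos hxl hlk, ?_, ?_, by abel⟩ <;>
    · simp only [mink_sub_left, mink_smul_left, hll, hkk, hkl]
      field_simp
      ring

lemma mink_self_neg_of_mink_pos_of_mink_neg {l k x : M4} (hl : l ∈ closedForwardCone)
    (hk : k ∈ closedForwardCone) (hxk : 0 < mink x k) (hxl : mink x l < 0) : mink x x < 0 := by
  by_contra! hx
  rcases le_total 0 (x 0) with h0 | h0
  · exact hxl.not_ge (mink_nonneg_of_mem_closedForwardCone ⟨hx, h0⟩ hl)
  · have hneg : -x ∈ closedForwardCone :=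
      ⟨by rwa [mink_neg_left, mink_comm, mink_neg_left, neg_neg], by simpa using h0⟩
    have := mink_nonneg_of_mem_closedForwardCone hneg hk
    rw [mink_neg_left] at this
    linarith

lemma smul_mem_ccomp {S : Set M4} (hS : ∀ c : ℝ, 0 < c → ∀ s ∈ S, c • s ∈ S) {c : ℝ}
    (hc : 0 < c) {x : M4} (hx : x ∈ ccomp S) : c • x ∈ ccomp S := by
  have himage : (c • ·) '' scomp S ⊆ scomp S := by
    rintro _ ⟨y, hy, rfl⟩ s hs
    have h := hy _ (hS c⁻¹ (inv_pos.2 hc) s hs)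
    have heq : c • y - s = c • (y - c⁻¹ • s) := by
      rw [smul_sub, smul_inv_smul₀ hc.ne']
    simp only [heq]
    rw [mink_smul_left, mink_comm, mink_smul_left]
    exact mul_neg_of_pos_of_neg hc (mul_neg_of_pos_of_neg hc h)
  exact interior_mono himage
    ((isOpenMap_smul₀ hc.ne').image_interior_subset _ ⟨x, hx, rfl⟩)

lemma sub_mem_ccomp {S : Set M4} (hS : ∀ s ∈ S, ∀ t ∈ S, s + t ∈ S) {x s : M4}
    (hx : x ∈ ccomp S) (hs : s ∈ S) : x - s ∈ ccomp S := by
  have himage : (· - s) '' scomp S ⊆ scomp S := by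
    rintro _ ⟨y, hy, rfl⟩ t ht
    have h := hy _ (hS s hs t ht)
    rwa [← sub_sub] at h
  exact interior_mono himage
    ((Homeomorph.subRight s).isOpenMap.image_interior_subset _ ⟨x, hx, rfl⟩)

/-- The causal complement of an open additive cone of spacelike vectors is star-shaped about the
opposite of any point of the cone. -/
lemma isPathConnected_ccomp_of_cone {S : Set M4} (hopen : IsOpen S) (hne : S.Nonempty)
    (hsmul : ∀ c : ℝ, 0 < c → ∀ s ∈ S, c • s ∈ S) (hadd : ∀ s ∈ S, ∀ t ∈ S, s + t ∈ S)
    (hspace : ∀ s ∈ S, mink s s < 0) : IsPathConnected (ccomp S) := by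
  obtain ⟨s, hs⟩ := hne
  have hsub : -S ⊆ ccomp S := by
    refine interior_maximal (fun x hx t ht => ?_) hopen.neg
    have h := hspace _ (hadd _ hx t ht)
    rwa [neg_add_eq_sub, ← neg_sub x t, mink_neg_left, mink_comm, mink_neg_left, neg_neg] at h
  have hs' : -s ∈ ccomp S := hsub (by simpa using hs)
  suffices h : StarConvex ℝ (-s) (ccomp S) from h.isPathConnected hs'
  intro x hx a b ha hb hab
  rcases hb.eq_or_lt with rfl | hb
  · obtain rfl : a = 1 := by linarith
    simpa using hs'
  rcases ha.eq_or_lt with rfl | ha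
  · obtain rfl : b = 1 := by linarith
    simpa using hx
  have h := sub_mem_ccomp hadd (smul_mem_ccomp hsmul hb hx) (hsmul a ha s hs)
  rwa [smul_neg, neg_add_eq_sub]

theorem ccomp_wedge_inter_isPathConnected (l l1 l2 : M4)
    (hl : Lightlike l) (h1 : Lightlike l1) (h2 : Lightlike l2)
    (hcl : l ∈ closedForwardCone) (hc1 : l1 ∈ closedForwardCone)
    (hc2 : l2 ∈ closedForwardCone)
    (hli1 : LinearIndependent ℝ ![l, l1]) (hli2 : LinearIndependent ℝ ![l, l2]) :
    IsPathConnected (ccomp (wedge l l1 ∩ wedge l l2)) := by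
  have hm1 := mink_pos_of_lightlike hl h1 hcl hc1 hli1
  have hm2 := mink_pos_of_lightlike hl h2 hcl hc2 hli2
  have hm12 := mink_nonneg_of_mem_closedForwardCone hc1 hc2
  have hW : wedge l l1 ∩ wedge l l2 = {x | 0 < mink x l1 ∧ 0 < mink x l2 ∧ mink x l < 0} := by
    ext x
    rw [Set.mem_inter_iff, mem_wedge_iff hl h1 hm1, mem_wedge_iff hl h2 hm2, Set.mem_ofPred_eq]
    tauto
  rw [hW]
  apply isPathConnected_ccomp_of_cone
  · exact (isOpen_lt continuous_const (continuous_mink_left l1)).inter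
      ((isOpen_lt continuous_const (continuous_mink_left l2)).inter
        (isOpen_lt (continuous_mink_left l) continuous_const))
  · refine ⟨(mink l1 l2 / mink l l1 + mink l1 l2 / mink l l2 + 1) • l - (l1 + l2), ?_, ?_, ?_⟩ <;>
      simp only [mink_sub_left, mink_add_left, mink_smul_left, hl.2, h1.2, h2.2, mink_comm l2 l1,
        mink_comm l1 l, mink_comm l2 l, add_mul, div_mul_cancel₀ _ hm1.ne',
        div_mul_cancel₀ _ hm2.ne']
    · have := mul_nonneg (div_nonneg hm12 hm2.le) hm1.le
      linarith
    · have := mul_nonneg (div_nonneg hm12 hm1.le) hm2.le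
      linarith
    · linarith
  · rintro c hc s ⟨hs1, hs2, hs⟩
    refine ⟨?_, ?_, ?_⟩ <;> rw [mink_smul_left]
    exacts [mul_pos hc hs1, mul_pos hc hs2, mul_neg_of_pos_of_neg hc hs]
  · rintro s ⟨hs1, hs2, hs⟩ t ⟨ht1, ht2, ht⟩
    refine ⟨?_, ?_, ?_⟩ <;> rw [mink_add_left] <;> linarith
  · rintro s ⟨hs1, -, hs⟩
    exact mink_self_neg_of_mink_pos_of_mink_neg hcl hc1 hs1 hs
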